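/- Let G be a multiloop-graph on a finite vertex set V, with degree sequence satisfying conditions (1) some vertex has odd degree and (2) some vertex v has k_v − (n−1) negative or odd, and suppose G has the maximum number of self-loops among all multiloop-graphs reachable from G by double edge swaps within G_ll. Then the non-loop edges of G form a disjoint union of isolated edges (no triangles and no open wedges occur); equivalently, G consists of exactly ⌊k_u/2⌋ self-loops at each vertex u together with a perfect matching on the vertices of odd degree. -/

import Mathlib

/-!
Multiset-based graphs: a graph on `V` is a multiset of unordered pairs (`Sym2 V`).
-/

variable {V : Type*}

/-- Degree of `u`: number of edge-endpoints at `u` (a self-loop at `u` contributes 2). -/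
def mDeg [DecidableEq V] (E : Multiset (Sym2 V)) (u : V) : ℕ :=
  (E.map fun e => if e = s(u, u) then 2 else if u ∈ e then 1 else 0).sum

/-- Loopy-multigraph: every self-loop occurs with multiplicity at most 1
(non-loop pairs may repeat). -/
def IsLoopyMultigraph [DecidableEq V] (E : Multiset (Sym2 V)) : Prop :=
  ∀ u : V, E.count s(u, u) ≤ 1

/-- Multiloop-graph: every non-loop pair occurs with multiplicity at most 1
(self-loops may repeat). -/
def IsMultiloopGraph [DecidableEq V] (E : Multiset (Sym2 V)) : Prop :=
  ∀ u v : V, u ≠ v → E.count s(u, v) ≤ 1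

/-- Double edge swap: remove edges `(u,v)`, `(x,y)` (counted with multiplicity),
add the edges `(u,x)`, `(v,y)`. -/
def DoubleEdgeSwap [DecidableEq V] (E E' : Multiset (Sym2 V)) : Prop :=
  ∃ u v x y : V, ({s(u, v), s(x, y)} : Multiset (Sym2 V)) ≤ E ∧
    E' = E - {s(u, v), s(x, y)} + {s(u, x), s(v, y)}

/-- Adjacency in the graph of graphs on the space of graphs satisfying `P`:
both graphs lie in the space and one is obtained from the other by a single double edge swap. -/
def GogAdj [DecidableEq V] (P : Multiset (Sym2 V) → Prop) (E E' : Multiset (Sym2 V)) : Prop :=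
  P E ∧ P E' ∧ (DoubleEdgeSwap E E' ∨ DoubleEdgeSwap E' E)

/-- The space of loopy-multigraphs with degree sequence `k`. -/
def LMGspace [DecidableEq V] (k : V → ℕ) (E : Multiset (Sym2 V)) : Prop :=
  IsLoopyMultigraph E ∧ ∀ u, mDeg E u = k u

/-- The space of multiloop-graphs with degree sequence `k`. -/
def MLGspace [DecidableEq V] (k : V → ℕ) (E : Multiset (Sym2 V)) : Prop :=
  IsMultiloopGraph E ∧ ∀ u, mDeg E u = k u

/-- Number of self-loops of `E` (counted with multiplicity). -/
def loopCount [DecidableEq V] (E : Multiset (Sym2 V)) : ℕ :=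
  (E.filter fun e => e.IsDiag).card

/-- An open wedge: non-loop edges `(u,v)`, `(u,x)` with `v ≠ x` such that `(v,x)` is not
an edge. -/
def HasOpenWedge [DecidableEq V] (E : Multiset (Sym2 V)) : Prop :=
  ∃ u v x : V, u ≠ v ∧ u ≠ x ∧ v ≠ x ∧ s(u, v) ∈ E ∧ s(u, x) ∈ E ∧ s(v, x) ∉ E

/-- The vertices joined to `u` by a non-loop edge of `E`. -/
def nonloopNeighbors [Fintype V] [DecidableEq V] (E : Multiset (Sym2 V)) (u : V) : Finset V :=
  Finset.univ.filter fun v => v ≠ u ∧ s(u, v) ∈ E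

theorem mem_nonloopNeighbors [Fintype V] [DecidableEq V] {E : Multiset (Sym2 V)} {u v : V} :
    v ∈ nonloopNeighbors E u ↔ v ≠ u ∧ s(u, v) ∈ E := by
  simp [nonloopNeighbors]

theorem mDeg_cons [DecidableEq V] (e : Sym2 V) (E : Multiset (Sym2 V)) (u : V) :
    mDeg (e ::ₘ E) u = (if e = s(u, u) then 2 else if u ∈ e then 1 else 0) + mDeg E u := by
  simp [mDeg]

theorem mDeg_add [DecidableEq V] (E F : Multiset (Sym2 V)) (u : V) :
    mDeg (E + F) u = mDeg E u + mDeg F u := by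
  simp [mDeg]

theorem mDeg_eq_sum_count [Fintype V] [DecidableEq V] (E : Multiset (Sym2 V)) (u : V) :
    mDeg E u = 2 * E.count s(u, u) + ∑ v ∈ Finset.univ.erase u, E.count s(u, v) := by
  induction E using Multiset.induction_on with
  | empty => simp [mDeg]
  | cons e E ih =>
    have key : (if e = s(u, u) then 2 else if u ∈ e then 1 else 0) =
        2 * (if s(u, u) = e then 1 else 0) +
          ∑ v ∈ Finset.univ.erase u, (if s(u, v) = e then 1 else 0) := by
      by_cases hu : u ∈ e
      · obtain ⟨w, rfl⟩ := Sym2.mem_iff_exists.1 hu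
        by_cases hw : w = u
        · subst hw
          simp [Finset.sum_ite_eq']
        · have hw' : u ≠ w := fun h => hw h.symm
          simp [Finset.sum_ite_eq', hw, hw']
      · have h : ∀ v, s(u, v) ≠ e := by
          rintro v rfl
          exact hu (Sym2.mem_mk_left u v)
        simp [hu, h, (h u).symm]
    simp only [mDeg_cons, Multiset.count_cons, Finset.sum_add_distrib, key, ih]
    ring

theorem IsMultiloopGraph.mDeg_eq [Fintype V] [DecidableEq V] {E : Multiset (Sym2 V)}
    (hE : IsMultiloopGraph E) (u : V) :
    mDeg E u = 2 * E.count s(u, u) + (nonloopNeighbors E u).card := by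
  rw [mDeg_eq_sum_count, nonloopNeighbors, Finset.card_filter,
    ← Finset.sum_erase (a := u) Finset.univ (by simp)]
  congr 1
  refine Finset.sum_congr rfl fun v hv => ?_
  have hvu : v ≠ u := (Finset.mem_erase.1 hv).1
  by_cases h : s(u, v) ∈ E
  · have h1 := hE u v hvu.symm
    have h2 := Multiset.one_le_count_iff_mem.2 h
    simp only [hvu, h, ne_eq, not_false_eq_true, and_self, if_true]
    omega
  · simp [h]

/-- A double edge swap on two distinct edges whose new non-loop edges are absent and distinct
stays in the space; it changes the loop count and the non-loop edges as expected. -/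
theorem MLGspace.exists_swap [DecidableEq V] {k : V → ℕ} {E : Multiset (Sym2 V)}
    (hE : MLGspace k E) {u v x y : V} (huv : s(u, v) ∈ E) (hxy : s(x, y) ∈ E)
    (hne : s(u, v) ≠ s(x, y)) (hux : u ≠ x → s(u, x) ∉ E) (hvy : v ≠ y → s(v, y) ∉ E)
    (hne' : s(u, x) ≠ s(v, y)) :
    ∃ E', GogAdj (MLGspace k) E E' ∧
      loopCount E' + ((if u = v then 1 else 0) + (if x = y then 1 else 0)) =
        loopCount E + ((if u = x then 1 else 0) + (if v = y then 1 else 0)) ∧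
      ∀ a b, a ≠ b → (s(a, b) ∈ E' ↔
        (s(a, b) ∈ E ∧ s(a, b) ≠ s(u, v) ∧ s(a, b) ≠ s(x, y)) ∨
          s(a, b) = s(u, x) ∨ s(a, b) = s(v, y)) := by
  have hle : ({s(u, v), s(x, y)} : Multiset (Sym2 V)) ≤ E := by
    refine (Multiset.le_iff_subset ?_).2 ?_
    · simpa using hne
    · intro e he
      simp only [Multiset.insert_eq_cons, Multiset.mem_cons, Multiset.mem_singleton] at he
      rcases he with rfl | rfl <;> assumption
  obtain ⟨R, rfl⟩ := Multiset.le_iff_exists_add.1 hle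
  have hR : ({s(u, v), s(x, y)} + R - {s(u, v), s(x, y)} + {s(u, x), s(v, y)} :
      Multiset (Sym2 V)) = {s(u, x), s(v, y)} + R := by
    rw [add_tsub_cancel_left, add_comm]
  have hcount : ∀ a b, a ≠ b → (s(a, b) = s(u, v) ∨ s(a, b) = s(x, y)) → s(a, b) ∉ R := by
    intro a b hab h hm
    have h1 := hE.1 a b hab
    have h2 := Multiset.one_le_count_iff_mem.2 hm
    have h3 : 1 ≤ Multiset.count s(a, b) {s(u, v), s(x, y)} :=
      Multiset.one_le_count_iff_mem.2 (by simpa using h)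
    rw [Multiset.count_add] at h1
    omega
  refine ⟨{s(u, x), s(v, y)} + R, ⟨hE, ⟨?_, ?_⟩, Or.inl ⟨u, v, x, y, hle, hR.symm⟩⟩, ?_, ?_⟩
  · intro a b hab
    have h1 := hE.1 a b hab
    rw [Multiset.count_add] at h1 ⊢
    by_cases hm : s(a, b) ∈ ({s(u, x), s(v, y)} : Multiset (Sym2 V))
    · have hnd : ({s(u, x), s(v, y)} : Multiset (Sym2 V)).Nodup := by simpa using hne'
      have h2 := Multiset.nodup_iff_count_le_one.1 hnd s(a, b)
      have h3 : s(a, b) ∉ R := by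
        simp only [Multiset.insert_eq_cons, Multiset.mem_cons, Multiset.mem_singleton] at hm
        intro hmR
        have hd : ¬ (s(a, b)).IsDiag := by simpa using hab
        rcases hm with hm | hm
        · rw [hm] at hmR hd
          exact hux (by simpa using hd) (Multiset.mem_add.2 (Or.inr hmR))
        · rw [hm] at hmR hd
          exact hvy (by simpa using hd) (Multiset.mem_add.2 (Or.inr hmR))
      rw [Multiset.count_eq_zero_of_notMem h3]
      omega
    · rw [Multiset.count_eq_zero_of_notMem hm]
      omega
  · intro w
    rw [← hE.2 w, mDeg_add, mDeg_add]
    congr 1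
    simp only [mDeg, Multiset.insert_eq_cons, Multiset.map_cons, Multiset.map_singleton,
      Multiset.sum_cons, Multiset.sum_singleton]
    grind [Sym2.eq_iff]
  · simp only [loopCount, Multiset.filter_add, Multiset.card_add, Multiset.insert_eq_cons,
      Multiset.filter_cons, Multiset.filter_singleton, Sym2.mk_isDiag_iff]
    split_ifs <;> simp <;> omega
  · intro a b hab
    have h := hcount a b hab
    simp only [Multiset.mem_add, Multiset.insert_eq_cons, Multiset.mem_cons,
      Multiset.mem_singleton]
    tauto

/-- Replacing an open wedge by a loop at its centre and the closing edge. -/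
theorem MLGspace.exists_swap_of_wedge [DecidableEq V] {k : V → ℕ} {E : Multiset (Sym2 V)}
    (hE : MLGspace k E) {u v x : V} (huv : u ≠ v) (hux : u ≠ x) (hvx : v ≠ x)
    (hv : s(u, v) ∈ E) (hx : s(u, x) ∈ E) (hn : s(v, x) ∉ E) :
    ∃ E', GogAdj (MLGspace k) E E' ∧ loopCount E' = loopCount E + 1 ∧
      ∀ a b, a ≠ b → (s(a, b) ∈ E' ↔
        (s(a, b) ∈ E ∧ s(a, b) ≠ s(u, v) ∧ s(a, b) ≠ s(u, x)) ∨ s(a, b) = s(v, x)) := by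
  obtain ⟨F, hF, hl, hm⟩ := hE.exists_swap hv hx (by simp [hvx, hux])
    (fun h => absurd rfl h) (fun _ => hn) (by simp [huv, hux])
  refine ⟨F, hF, by simpa [huv, hux, hvx] using hl, fun a b hab => ?_⟩
  have : s(a, b) ≠ s(u, u) := by
    intro h
    have hd : ¬ (s(a, b)).IsDiag := by simpa using hab
    rw [h] at hd
    simp at hd
  rw [hm a b hab]
  tauto

section Maximal

variable [DecidableEq V] {k : V → ℕ} {E : Multiset (Sym2 V)}

theorem not_hasOpenWedge_of_maximal
    (hmax : ∀ E', Relation.ReflTransGen (GogAdj (MLGspace k)) E E' → loopCount E' ≤ loopCount E)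
    {F : Multiset (Sym2 V)} (hF : MLGspace k F)
    (hEF : Relation.ReflTransGen (GogAdj (MLGspace k)) E F) (hl : loopCount E ≤ loopCount F) :
    ¬ HasOpenWedge F := by
  rintro ⟨u, v, x, huv, hux, hvx, hv, hx, hn⟩
  obtain ⟨F', hF', hl', -⟩ := hF.exists_swap_of_wedge huv hux hvx hv hx hn
  have := hmax F' (hEF.tail hF')
  omega

/-- Non-loop adjacency is transitive when there is no open wedge. -/
theorem mem_of_not_hasOpenWedge (hE : ¬ HasOpenWedge E) {a b c : V} (hba : b ≠ a) (hbc : b ≠ c)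
    (hac : a ≠ c) (ha : s(a, b) ∈ E) (hc : s(b, c) ∈ E) : s(a, c) ∈ E := by
  by_contra h
  exact hE ⟨b, a, c, hba, hbc, hac, by rwa [Sym2.eq_swap], hc, h⟩

theorem isolated_of_maximal_of_wedge (hE : MLGspace k E)
    (hmax : ∀ E', Relation.ReflTransGen (GogAdj (MLGspace k)) E E' → loopCount E' ≤ loopCount E)
    {u v x : V} (huv : u ≠ v) (hux : u ≠ x) (hvx : v ≠ x) (hv : s(u, v) ∈ E)
    (hx : s(u, x) ∈ E) {w : V} (hwu : w ≠ u) (hw : s(u, w) ∉ E) {z : V} (hzw : z ≠ w) :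
    s(w, z) ∉ E := by
  intro hwz
  have hno := not_hasOpenWedge_of_maximal hmax hE .refl le_rfl
  have hwv : w ≠ v := by rintro rfl; exact hw hv
  have hwx : w ≠ x := by rintro rfl; exact hw hx
  have hzu : z ≠ u := by rintro rfl; exact hw (by rwa [Sym2.eq_swap])
  have huz : s(u, z) ∉ E := fun h =>
    hw (mem_of_not_hasOpenWedge hno hzu hzw hwu.symm h (by rwa [Sym2.eq_swap]))
  have hzv : z ≠ v := by rintro rfl; exact huz hv
  have hxw : s(x, w) ∉ E := fun h =>
    hw (mem_of_not_hasOpenWedge hno hux.symm hwx.symm hwu.symm hx h)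
  have hvz : s(v, z) ∉ E := fun h =>
    huz (mem_of_not_hasOpenWedge hno huv.symm hzv.symm hzu.symm hv h)
  obtain ⟨F, hF, hl, hm⟩ := hE.exists_swap hv hwz (by simp [hwu.symm, hzu.symm])
    (fun _ => hw) (fun _ => hvz) (by simp [huv, hzu.symm])
  simp only [huv, hzw.symm, hwu.symm, hzv.symm, if_false, add_zero] at hl
  refine not_hasOpenWedge_of_maximal hmax hF.2.1 (.single hF) hl.ge
    ⟨u, x, w, hux, hwu.symm, hwx.symm, ?_, ?_, ?_⟩
  · rw [hm _ _ hux]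
    left
    simp [hx, hwu.symm, hzu.symm, hvx.symm, huv]
  · rw [hm _ _ hwu.symm]
    simp
  · rw [hm _ _ hwx.symm]
    simp [hxw, hux.symm, hwx.symm, hwu, hwv, hvx.symm]

theorem neighbor_eq_or_eq_of_maximal_of_wedge (hE : MLGspace k E)
    (hmax : ∀ E', Relation.ReflTransGen (GogAdj (MLGspace k)) E E' → loopCount E' ≤ loopCount E)
    {u v x : V} (huv : u ≠ v) (hux : u ≠ x) (hvx : v ≠ x) (hv : s(u, v) ∈ E)
    (hx : s(u, x) ∈ E) {w : V} (hwu : w ≠ u) (hw : s(u, w) ∉ E) (hww : s(w, w) ∈ E)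
    {t : V} (htu : t ≠ u) (ht : s(u, t) ∈ E) : t = v ∨ t = x := by
  by_contra! hne
  obtain ⟨htv, htx⟩ := hne
  have hno := not_hasOpenWedge_of_maximal hmax hE .refl le_rfl
  have hiso : ∀ z, z ≠ w → s(w, z) ∉ E := fun z hz =>
    isolated_of_maximal_of_wedge hE hmax huv hux hvx hv hx hwu hw hz
  have hwv : w ≠ v := by rintro rfl; exact hw hv
  have hwx : w ≠ x := by rintro rfl; exact hw hx
  have hwt : w ≠ t := by rintro rfl; exact hw ht
  have hvw : s(v, w) ∉ E := by rw [Sym2.eq_swap]; exact hiso v hwv.symm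
  have hxw : s(x, w) ∉ E := by rw [Sym2.eq_swap]; exact hiso x hwx.symm
  have hvt : s(t, v) ∈ E := mem_of_not_hasOpenWedge hno htu.symm huv htv
    (by rwa [Sym2.eq_swap]) hv
  obtain ⟨F, hF, hl, hm⟩ := hE.exists_swap hv hww (by simp [hwu.symm])
    (fun _ => hw) (fun _ => hvw) (by simp [huv, hwu.symm])
  simp only [huv, hwu.symm, hwv.symm, if_false, if_true] at hl
  obtain ⟨F', hF', hl', hm'⟩ := hF.2.1.exists_swap_of_wedge hux hwu.symm hwx.symm
    (by rw [hm _ _ hux]; left; simp [hx, hwu.symm, hvx.symm, huv])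
    (by rw [hm _ _ hwu.symm]; simp)
    (by rw [hm _ _ hwx.symm]; simp [hxw, hux.symm, hwx.symm, hwu, hwv, hvx.symm])
  refine not_hasOpenWedge_of_maximal hmax hF'.2.1 ((Relation.ReflTransGen.single hF).tail hF')
    (by omega) ⟨t, u, v, htu, htv, huv, ?_, ?_, ?_⟩
  · rw [hm' _ _ htu, hm _ _ htu]
    have : s(t, u) ∈ E := by rwa [Sym2.eq_swap]
    left
    simp [this, htu, htv, htx, hwt.symm, hux, hwu.symm, huv]
  · rw [hm' _ _ htv, hm _ _ htv]
    left
    simp [hvt, htu, htv, htx, hwt.symm, hwv.symm, huv.symm]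
  · rw [hm' _ _ huv, hm _ _ huv]
    simp [huv, hux, hwu.symm, hwv.symm, hvx]

end Maximal

/-- if `k` (all degrees positive) satisfies the two connectivity conditions
and a multiloop-graph `E` with degree sequence `k` has the maximum number of self-loops
among all multiloop-graphs reachable from it by double edge swaps within the gog, then its
non-loop edges form a disjoint union of isolated edges: no vertex has two distinct non-loop
neighbors, each vertex carries exactly `⌊k u / 2⌋` self-loops, and the non-loop edges form
a perfect matching on the odd-degree vertices. -/
theorem maximal_loops_structure {V : Type*} [Fintype V] [DecidableEq V]
    (k : V → ℕ) (hk : ∀ u, 1 ≤ k u)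
    (h1 : ∃ u, Odd (k u))
    (h2 : ∃ v, (k v : ℤ) - ((Fintype.card V : ℤ) - 1) < 0 ∨
      Odd ((k v : ℤ) - ((Fintype.card V : ℤ) - 1)))
    (E : Multiset (Sym2 V)) (hE : MLGspace k E)
    (hmax : ∀ E' : Multiset (Sym2 V),
      Relation.ReflTransGen (GogAdj (MLGspace k)) E E' → loopCount E' ≤ loopCount E) :
    (∀ u v x : V, u ≠ v → u ≠ x → v ≠ x → s(u, v) ∈ E → s(u, x) ∈ E → False) ∧
      (∀ u : V, E.count s(u, u) = k u / 2) ∧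
      (∀ u : V, Odd (k u) → ∃ v : V, v ≠ u ∧ s(u, v) ∈ E) ∧
      (∀ u v : V, u ≠ v → s(u, v) ∈ E → Odd (k u) ∧ Odd (k v)) := by
  have hno := not_hasOpenWedge_of_maximal hmax hE .refl le_rfl
  have hdeg : ∀ u, k u = 2 * E.count s(u, u) + (nonloopNeighbors E u).card := fun u => by
    rw [← hE.2 u, hE.1.mDeg_eq]
  have hnot_clique : ∀ u, ∃ w, w ≠ u ∧ s(u, w) ∉ E := by
    intro u
    by_contra! h
    have hall : ∀ a b, b ≠ a → s(a, b) ∈ E := by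
      intro a b hba
      by_cases ha : a = u
      · subst ha; exact h b hba
      by_cases hb : b = u
      · subst hb; rw [Sym2.eq_swap]; exact h a hba.symm
      exact mem_of_not_hasOpenWedge hno (Ne.symm ha) (Ne.symm hb) hba.symm
        (by rw [Sym2.eq_swap]; exact h a ha) (h b hb)
    obtain ⟨v, hv⟩ := h2
    have hN : nonloopNeighbors E v = Finset.univ.erase v := by
      ext z
      simpa [mem_nonloopNeighbors] using hall v z
    have hd := hdeg v
    rw [hN, Finset.card_erase_of_mem (Finset.mem_univ v), Finset.card_univ] at hd
    have hpos : 0 < Fintype.card V := Fintype.card_pos_iff.2 ⟨v⟩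
    rcases hv with hv | ⟨m, hv⟩ <;> omega
  have hwedge : ∀ u v x : V, u ≠ v → u ≠ x → v ≠ x → s(u, v) ∈ E → s(u, x) ∈ E → False := by
    have hpair : ∀ u v x : V, u ≠ v → u ≠ x → v ≠ x → s(u, v) ∈ E → s(u, x) ∈ E →
        (nonloopNeighbors E u).card = 2 := by
      intro u v x huv hux hvx hv hx
      obtain ⟨w, hwu, hw⟩ := hnot_clique u
      have hww : s(w, w) ∈ E := by
        have hN : nonloopNeighbors E w = ∅ := by
          refine Finset.eq_empty_of_forall_notMem fun z hz => ?_
          rw [mem_nonloopNeighbors] at hz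
          exact isolated_of_maximal_of_wedge hE hmax huv hux hvx hv hx hwu hw hz.1 hz.2
        have h := hdeg w
        have := hk w
        rw [hN, Finset.card_empty] at h
        exact Multiset.one_le_count_iff_mem.1 (by omega)
      rw [Finset.card_eq_two]
      refine ⟨v, x, hvx, ?_⟩
      ext t
      simp only [mem_nonloopNeighbors, Finset.mem_insert, Finset.mem_singleton]
      constructor
      · rintro ⟨htu, ht⟩
        exact neighbor_eq_or_eq_of_maximal_of_wedge hE hmax huv hux hvx hv hx hwu hw hww htu ht
      · rintro (rfl | rfl)
        · exact ⟨huv.symm, hv⟩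
        · exact ⟨hux.symm, hx⟩
    intro u v x huv hux hvx hv hx
    obtain ⟨o, m, ho⟩ := h1
    have hd := hdeg o
    by_cases hou : o = u
    · subst hou
      have := hpair o v x huv hux hvx hv hx
      omega
    by_cases hadj : s(u, o) ∈ E
    · obtain ⟨z, hzu, hzo, hz⟩ : ∃ z, z ≠ u ∧ z ≠ o ∧ s(u, z) ∈ E := by
        by_cases hov : o = v
        · exact ⟨x, hux.symm, by rw [hov]; exact hvx.symm, hx⟩
        · exact ⟨v, huv.symm, Ne.symm hov, hv⟩
      have hou' : s(o, u) ∈ E := by rwa [Sym2.eq_swap]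
      have := hpair o u z hou hzo.symm hzu.symm hou'
        (mem_of_not_hasOpenWedge hno (Ne.symm hou) hzu.symm hzo.symm hou' hz)
      omega
    · have hN : nonloopNeighbors E o = ∅ := by
        refine Finset.eq_empty_of_forall_notMem fun z hz => ?_
        rw [mem_nonloopNeighbors] at hz
        exact isolated_of_maximal_of_wedge hE hmax huv hux hvx hv hx hou hadj hz.1 hz.2
      rw [hN, Finset.card_empty] at hd
      omega
  have hcard : ∀ u, (nonloopNeighbors E u).card ≤ 1 := by
    intro u
    refine Finset.card_le_one.2 fun a ha b hb => ?_
    rw [mem_nonloopNeighbors] at ha hb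
    by_contra hab
    exact hwedge u a b ha.1.symm hb.1.symm hab ha.2 hb.2
  have hodd : ∀ u v, v ≠ u → s(u, v) ∈ E → Odd (k u) := by
    intro u v hvu huv
    have h : 0 < (nonloopNeighbors E u).card :=
      Finset.card_pos.2 ⟨v, mem_nonloopNeighbors.2 ⟨hvu, huv⟩⟩
    have h1 := hcard u
    exact ⟨E.count s(u, u), by rw [hdeg u]; omega⟩
  refine ⟨hwedge, fun u => ?_, fun u hu => ?_, fun u v huv h => ?_⟩
  · have h1 := hdeg u
    have h2 := hcard u
    omega
  · obtain ⟨m, hm⟩ := hu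
    have h1 := hdeg u
    have hpos : 0 < (nonloopNeighbors E u).card := by omega
    obtain ⟨v, hv⟩ := Finset.card_pos.1 hpos
    exact ⟨v, mem_nonloopNeighbors.1 hv⟩
  · exact ⟨hodd u v huv.symm h, hodd v u huv (by rwa [Sym2.eq_swap])⟩
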